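/- Suppose conditions (1.4) and (1.5) hold and that f(0) > 0. Then the problem ∂_t^k u − Σ_{|α|=m} ∂^α a_α(x,t,u) ≥ f(|u|) in ℝ^{n+1}_+ with initial data ∂_t^i u(·,0) = u_i (0 ≤ i ≤ k−1) has no global weak solution at all. -/

import Mathlib

open MeasureTheory Real Set Filter

noncomputable section

/-- The spatial domain `ℝⁿ`. -/
abbrev Spc (n : ℕ) := EuclideanSpace ℝ (Fin n)

/-- The open ball `B_r` in `ℝⁿ` of radius `r` centered at `0`. -/
def ball0 (n : ℕ) (r : ℝ) : Set (Spc n) := Metric.ball 0 r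

/-- The cylinder `Q_r^κ = B_r × (0, r^κ)`. -/
def cyl (n : ℕ) (r κ : ℝ) : Set (Spc n × ℝ) := ball0 n r ×ˢ Ioo 0 (r ^ κ)

/-- The half-space `ℝ^{n+1}_+ = ℝⁿ × (0, ∞)`. -/
def halfSp (n : ℕ) : Set (Spc n × ℝ) := {z | 0 < z.2}

/-- The (finite) set of multi-indices `α` with `|α| = m`. -/
def mIdx (n m : ℕ) : Finset (Fin n → ℕ) :=
  (Fintype.piFinset fun _ : Fin n => Finset.range (m + 1)).filter fun α => ∑ i, α i = m

/-- Spatial partial derivative `∂/∂x_i`. -/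
def spDeriv (n : ℕ) (i : Fin n) (φ : Spc n × ℝ → ℝ) : Spc n × ℝ → ℝ :=
  fun z => deriv (fun s : ℝ => φ (z.1 + s • EuclideanSpace.single i (1 : ℝ), z.2)) 0

/-- Time derivative `∂/∂t`. -/
def tDeriv (n : ℕ) (φ : Spc n × ℝ → ℝ) : Spc n × ℝ → ℝ :=
  fun z => deriv (fun s : ℝ => φ (z.1, s)) z.2

/-- Multi-index spatial derivative `∂^α`. -/
def mDeriv (n : ℕ) (α : Fin n → ℕ) (φ : Spc n × ℝ → ℝ) : Spc n × ℝ → ℝ :=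
  (List.finRange n).foldr (fun i ψ => (spDeriv n i)^[α i] ψ) φ

/-- Caratheodory conditions and the growth bound `|a_α(x,t,ζ)| ≤ A |ζ|^p` for the
coefficients of the operator `L`. -/
def GoodCoeffs (n m : ℕ) (A p : ℝ) (a : (Fin n → ℕ) → Spc n × ℝ → ℝ → ℝ) : Prop :=
  ∀ α ∈ mIdx n m,
    (∀ ζ : ℝ, Measurable fun z => a α z ζ) ∧
    (∀ᵐ z ∂(volume.restrict (halfSp n)), Continuous fun ζ => a α z ζ) ∧
    (∀ᵐ z ∂(volume.restrict (halfSp n)), ∀ ζ : ℝ, |a α z ζ| ≤ A * |ζ| ^ p)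

/-- The standing conditions on `f`: `ζ ↦ f ζ` and `ζ ↦ f (ζ^{1/p})` are nondecreasing
and convex on `[0,∞)`, and `f` is positive on `(0,∞)`. -/
def GoodF (p : ℝ) (f : ℝ → ℝ) : Prop :=
  MonotoneOn f (Ici 0) ∧ ConvexOn ℝ (Ici 0) f ∧
  MonotoneOn (fun ζ => f (ζ ^ (1 / p))) (Ici 0) ∧
  ConvexOn ℝ (Ici 0) (fun ζ => f (ζ ^ (1 / p))) ∧
  ∀ ζ : ℝ, 0 < ζ → 0 < f ζ

/-- Condition (1.4): `∫_1^∞ ζ^{1/k - 1} f(ζ)^{-1/k} dζ < ∞`. -/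
def Cond14 (k : ℕ) (f : ℝ → ℝ) : Prop :=
  IntegrableOn (fun ζ : ℝ => ζ ^ ((k : ℝ)⁻¹ - 1) / f ζ ^ ((k : ℝ)⁻¹)) (Ioi 1)

/-- Condition (1.5): `∫_1^∞ ζ^{p/m - 1} f(ζ)^{-1/m} dζ < ∞`. -/
def Cond15 (m : ℕ) (p : ℝ) (f : ℝ → ℝ) : Prop :=
  IntegrableOn (fun ζ : ℝ => ζ ^ (p / (m : ℝ) - 1) / f ζ ^ ((m : ℝ)⁻¹)) (Ioi 1)

/-- `v ∈ L^1_loc(ℝⁿ)`. -/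
def L1locInit (n : ℕ) (v : Spc n → ℝ) : Prop :=
  ∀ r : ℝ, 0 < r → IntegrableOn v (ball0 n r)

/-- `u` is a global weak solution of
`∂_t^k u - Σ_{|α| = m} ∂^α a_α(x,t,u) ≥ f(|u|)` in `ℝ^{n+1}_+`, with initial data
`∂_t^i u(·,0) = u0 i` for `0 ≤ i ≤ k-1`. -/
def IsGlobalWeakSol (n k m : ℕ) (p : ℝ) (a : (Fin n → ℕ) → Spc n × ℝ → ℝ → ℝ)
    (f : ℝ → ℝ) (u0 : ℕ → Spc n → ℝ) (u : Spc n × ℝ → ℝ) : Prop :=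
  (∀ r : ℝ, 0 < r → IntegrableOn u (cyl n r 1)) ∧
  (∀ r : ℝ, 0 < r → IntegrableOn (fun z => |u z| ^ p) (cyl n r 1)) ∧
  (∀ r : ℝ, 0 < r → IntegrableOn (fun z => f |u z|) (cyl n r 1)) ∧
  ∀ φ : Spc n × ℝ → ℝ, ContDiff ℝ (⊤ : ℕ∞) φ → HasCompactSupport φ →
    (∀ z, 0 ≤ φ z) →
    (∫ z in halfSp n, (-1 : ℝ) ^ k * u z * (tDeriv n)^[k] φ z)
      - (∫ z in halfSp n, ∑ α ∈ mIdx n m, (-1 : ℝ) ^ m * a α z (u z) * mDeriv n α φ z)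
    ≥ (∫ x : Spc n, ∑ i ∈ Finset.range k,
          (-1 : ℝ) ^ i * u0 (k - 1 - i) x * (tDeriv n)^[i] φ (x, 0))
      + ∫ z in halfSp n, f |u z| * φ z

/-- `u = 0` almost everywhere in `ℝ^{n+1}_+`. -/
def TrivialSol (n : ℕ) (u : Spc n × ℝ → ℝ) : Prop :=
  ∀ᵐ z ∂(volume.restrict (halfSp n)), u z = 0

/-- A smooth plateau function equal to `1` on `[-r, r]` and vanishing outside `[-(r+d), r+d]`. -/
def plateau (r d : ℝ) (s : ℝ) : ℝ :=
  smoothTransition ((-1 / d) * s + (r + d) / d) + smoothTransition ((1 / d) * s + (r + d) / d) - 1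

theorem iterate_deriv_comp_affine {F : ℝ → ℝ} (c b : ℝ) (l : ℕ) :
    deriv^[l] (fun s => F (c * s + b)) = fun s => c ^ l * (deriv^[l] F) (c * s + b) := by
  induction l with
  | zero => simp
  | succ l ih =>
    rw [Function.iterate_succ_apply', ih]
    funext s
    rw [deriv_const_mul_field, Function.iterate_succ_apply', pow_succ, mul_assoc]
    congr 1
    have h1 := deriv_comp_mul_left c (fun y => (deriv^[l] F) (y + b)) s
    rw [h1, deriv_comp_add_const, smul_eq_mul]

theorem contDiff_plateau (r d : ℝ) {l : WithTop ℕ∞} (hl : l ≤ (⊤ : ℕ∞)) :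
    ContDiff ℝ l (plateau r d) := by
  unfold plateau
  have h : ContDiff ℝ l smoothTransition := (smoothTransition.contDiff (n := ⊤)).of_le hl
  exact ((h.comp (by fun_prop)).add (h.comp (by fun_prop))).sub contDiff_const

theorem plateau_eq_one {r d s : ℝ} (hd : 0 < d) (hs : |s| ≤ r) : plateau r d s = 1 := by
  rw [abs_le] at hs
  unfold plateau
  rw [smoothTransition.one_of_one_le, smoothTransition.one_of_one_le]
  · norm_num
  · rw [div_mul_eq_mul_div, ← add_div, le_div_iff₀ hd]; linarith
  · rw [div_mul_eq_mul_div, ← add_div, le_div_iff₀ hd]; linarith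

theorem plateau_eq_zero {r d s : ℝ} (hr : 0 < r) (hd : 0 < d) (hs : r + d ≤ |s|) :
    plateau r d s = 0 := by
  unfold plateau
  rcases le_abs.1 hs with h | h
  · rw [smoothTransition.zero_of_nonpos, smoothTransition.one_of_one_le]
    · norm_num
    · rw [div_mul_eq_mul_div, ← add_div, le_div_iff₀ hd]; linarith
    · rw [div_mul_eq_mul_div, ← add_div]; exact div_nonpos_of_nonpos_of_nonneg (by linarith) hd.le
  · rw [smoothTransition.one_of_one_le, smoothTransition.zero_of_nonpos]
    · norm_num
    · rw [div_mul_eq_mul_div, ← add_div]; exact div_nonpos_of_nonpos_of_nonneg (by linarith) hd.le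
    · rw [div_mul_eq_mul_div, ← add_div, le_div_iff₀ hd]; linarith

theorem plateau_mem_Icc {r d : ℝ} (hr : 0 < r) (hd : 0 < d) (s : ℝ) :
    plateau r d s ∈ Icc (0 : ℝ) 1 := by
  unfold plateau
  have a0 := smoothTransition.nonneg ((-1 / d) * s + (r + d) / d)
  have a1 := smoothTransition.le_one ((-1 / d) * s + (r + d) / d)
  have b0 := smoothTransition.nonneg ((1 / d) * s + (r + d) / d)
  have b1 := smoothTransition.le_one ((1 / d) * s + (r + d) / d)
  rcases le_total 0 s with h | h
  · have : smoothTransition ((1 / d) * s + (r + d) / d) = 1 := by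
      apply smoothTransition.one_of_one_le
      rw [div_mul_eq_mul_div, ← add_div, le_div_iff₀ hd]; linarith
    constructor <;> linarith
  · have : smoothTransition ((-1 / d) * s + (r + d) / d) = 1 := by
      apply smoothTransition.one_of_one_le
      rw [div_mul_eq_mul_div, ← add_div, le_div_iff₀ hd]; linarith
    constructor <;> linarith

theorem iterate_deriv_eqOn_of_isOpen {F G : ℝ → ℝ} {U : Set ℝ} (hU : IsOpen U) (h : EqOn F G U)
    (l : ℕ) : EqOn (deriv^[l] F) (deriv^[l] G) U := by
  rw [← iteratedDeriv_eq_iterate, ← iteratedDeriv_eq_iterate]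
  exact h.iteratedDeriv_of_isOpen hU l

theorem iterate_deriv_const_of_pos (c : ℝ) {l : ℕ} (hl : 0 < l) (s : ℝ) :
    (deriv^[l] (fun _ : ℝ => c)) s = 0 := by
  rw [← iteratedDeriv_eq_iterate, iteratedDeriv_const, if_neg hl.ne']

theorem iterate_deriv_plateau_of_lt_abs {r d s : ℝ} (hr : 0 < r) (hd : 0 < d) (hs : r + d < |s|)
    (l : ℕ) : (deriv^[l] (plateau r d)) s = 0 := by
  have hU : IsOpen {s : ℝ | r + d < |s|} := isOpen_lt continuous_const continuous_abs
  rw [iterate_deriv_eqOn_of_isOpen hU (G := fun _ => 0)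
    (fun x hx => plateau_eq_zero hr hd (le_of_lt hx)) l hs]
  rw [← iteratedDeriv_eq_iterate, iteratedDeriv_const]; simp

theorem iterate_deriv_plateau_zero {r d : ℝ} (hr : 0 < r) (hd : 0 < d) {l : ℕ} (hl : 0 < l) :
    (deriv^[l] (plateau r d)) 0 = 0 := by
  have hU : IsOpen {s : ℝ | |s| < r} := isOpen_lt continuous_abs continuous_const
  rw [iterate_deriv_eqOn_of_isOpen hU (G := fun _ => 1)
    (fun x hx => plateau_eq_one hd (le_of_lt hx)) l (by simpa using hr)]
  exact iterate_deriv_const_of_pos _ hl _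

theorem exists_bound_iterate_deriv_smoothTransition (l : ℕ) :
    ∃ K : ℝ, 0 ≤ K ∧ ∀ s, |(deriv^[l] smoothTransition) s| ≤ K := by
  rcases Nat.eq_zero_or_pos l with rfl | hl
  · refine ⟨1, zero_le_one, fun s => ?_⟩
    simpa [abs_of_nonneg (smoothTransition.nonneg s)] using smoothTransition.le_one s
  have hc : Continuous (deriv^[l] smoothTransition) := by
    rw [← iteratedDeriv_eq_iterate]
    exact (smoothTransition.contDiff (n := ⊤)).continuous_iteratedDeriv l (by exact_mod_cast le_top)
  obtain ⟨K, hK⟩ := isCompact_Icc.exists_bound_of_continuousOn (s := Icc (0 : ℝ) 1) hc.continuousOn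
  refine ⟨K, (norm_nonneg _).trans (hK 0 (by simp)), fun s => ?_⟩
  have hK0 : 0 ≤ K := (norm_nonneg _).trans (hK 0 (by simp))
  by_cases h0 : s < 0
  · rw [iterate_deriv_eqOn_of_isOpen isOpen_Iio (G := fun _ => 0)
      (fun x hx => smoothTransition.zero_of_nonpos (le_of_lt hx)) l h0,
      iterate_deriv_const_of_pos _ hl]
    simpa
  by_cases h1 : 1 < s
  · rw [iterate_deriv_eqOn_of_isOpen isOpen_Ioi (G := fun _ => 1)
      (fun x hx => smoothTransition.one_of_one_le (le_of_lt hx)) l h1,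
      iterate_deriv_const_of_pos _ hl]
    simpa
  exact hK s ⟨not_lt.1 h0, not_lt.1 h1⟩

theorem exists_bound_iterate_deriv_plateau (l : ℕ) :
    ∃ K : ℝ, 0 ≤ K ∧ ∀ r d : ℝ, 0 < r → 0 < d → ∀ s,
      |(deriv^[l] (plateau r d)) s| ≤ K * (d⁻¹) ^ l := by
  obtain ⟨K, hK0, hK⟩ := exists_bound_iterate_deriv_smoothTransition l
  refine ⟨2 * K + 1, by linarith, fun r d hr hd s => ?_⟩
  rcases Nat.eq_zero_or_pos l with rfl | hl
  · have := plateau_mem_Icc hr hd s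
    simp only [Function.iterate_zero, id, pow_zero, mul_one]
    rw [abs_of_nonneg this.1]; linarith [this.2]
  have hS : ∀ c b : ℝ, ContDiff ℝ l (fun s => smoothTransition (c * s + b)) := fun c b =>
    (smoothTransition.contDiff (n := l)).comp (by fun_prop)
  have key : (deriv^[l] (plateau r d)) s
      = (-1 / d) ^ l * (deriv^[l] smoothTransition) ((-1 / d) * s + (r + d) / d)
        + (1 / d) ^ l * (deriv^[l] smoothTransition) ((1 / d) * s + (r + d) / d) := by
    have e1 := congrFun (iterate_deriv_comp_affine (F := smoothTransition) (-1 / d) ((r + d) / d) l) s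
    have e2 := congrFun (iterate_deriv_comp_affine (F := smoothTransition) (1 / d) ((r + d) / d) l) s
    rw [← e1, ← e2]
    simp only [← iteratedDeriv_eq_iterate]
    have : plateau r d = (fun s => smoothTransition ((-1 / d) * s + (r + d) / d)) +
      (fun s => smoothTransition ((1 / d) * s + (r + d) / d)) - (fun _ => 1) := rfl
    have hadd : ContDiff ℝ l ((fun s => smoothTransition ((-1 / d) * s + (r + d) / d)) +
      (fun s => smoothTransition ((1 / d) * s + (r + d) / d))) := (hS _ _).add (hS _ _)
    rw [this, iteratedDeriv_sub hadd.contDiffAt contDiff_const.contDiffAt,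
      iteratedDeriv_add (hS _ _).contDiffAt (hS _ _).contDiffAt,
      iteratedDeriv_const, if_neg hl.ne', sub_zero]
  rw [key]
  refine (abs_add_le _ _).trans ?_
  rw [abs_mul, abs_mul, abs_pow, abs_pow, abs_div, abs_div, abs_neg, abs_one, abs_of_pos hd, one_div]
  have hp : 0 < (d⁻¹) ^ l := by positivity
  nlinarith [mul_le_mul_of_nonneg_left (hK ((-1 / d) * s + (r + d) / d)) hp.le,
    mul_le_mul_of_nonneg_left (hK ((d⁻¹) * s + (r + d) / d)) hp.le]

/-- The closed cube `[-r, r]ⁿ`. -/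
def cube (n : ℕ) (r : ℝ) : Set (Spc n) := {x | ∀ i, |x i| ≤ r}

/-- The space-time box `[-r, r]ⁿ × (0, τ]`. -/
def box (n : ℕ) (r τ : ℝ) : Set (Spc n × ℝ) := cube n r ×ˢ Ioc 0 τ

theorem measurableSet_cube (n : ℕ) (r : ℝ) : MeasurableSet (cube n r) := by
  have : IsClosed (cube n r) := by
    simp only [cube, ofPred_forall]
    exact isClosed_iInter fun i => isClosed_le (by fun_prop) continuous_const
  exact this.measurableSet

theorem measurableSet_box (n : ℕ) (r τ : ℝ) : MeasurableSet (box n r τ) :=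
  (measurableSet_cube n r).prod measurableSet_Ioc

theorem box_mono (n : ℕ) {r r' τ τ' : ℝ} (hr : r ≤ r') (hτ : τ ≤ τ') :
    box n r τ ⊆ box n r' τ' :=
  prod_mono (fun _ hx i => (hx i).trans hr) (Ioc_subset_Ioc_right hτ)

theorem volume_cube (n : ℕ) {r : ℝ} (hr : 0 ≤ r) :
    volume (cube n r) = ENNReal.ofReal ((2 * r) ^ n) := by
  have h : cube n r = WithLp.ofLp ⁻¹' (Set.pi univ fun _ : Fin n => Icc (-r) r) := by
    ext x
    simp [cube, abs_le, Pi.le_def, forall_and]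
  rw [h, (PiLp.volume_preserving_ofLp (Fin n)).measure_preimage
    (MeasurableSet.univ_pi fun _ => measurableSet_Icc).nullMeasurableSet, volume_pi_pi]
  simp only [Real.volume_Icc, Finset.prod_const, Finset.card_univ, Fintype.card_fin]
  rw [← ENNReal.ofReal_pow (by linarith)]
  ring_nf

theorem volume_box (n : ℕ) {r τ : ℝ} (hr : 0 ≤ r) :
    volume (box n r τ) = ENNReal.ofReal ((2 * r) ^ n * τ) := by
  rw [box, Measure.volume_eq_prod, Measure.prod_prod, volume_cube n hr, Real.volume_Ioc, sub_zero,
    ENNReal.ofReal_mul (by positivity)]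

theorem measureReal_box (n : ℕ) {r τ : ℝ} (hr : 0 ≤ r) (hτ : 0 ≤ τ) :
    volume.real (box n r τ) = (2 * r) ^ n * τ := by
  rw [measureReal_def, volume_box n hr, ENNReal.toReal_ofReal (by positivity)]

theorem cube_subset_closedBall (n : ℕ) (r : ℝ) : cube n r ⊆ Metric.closedBall 0 (n * r) := by
  intro x hx
  rw [mem_closedBall_zero_iff]
  have h := (EuclideanSpace.basisFun (Fin n) ℝ).sum_repr x
  rw [← h]
  refine (norm_sum_le _ _).trans ?_
  refine (Finset.sum_le_card_nsmul _ _ r fun i _ => ?_).trans (by simp)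
  simpa [norm_smul] using hx i

theorem exists_box_subset_cyl (n : ℕ) (r τ : ℝ) : ∃ ρ, 0 < ρ ∧ box n r τ ⊆ cyl n ρ 1 := by
  refine ⟨max (n * r) (max τ 0) + 1, ?_, ?_⟩
  · have := le_max_right τ 0
    have := le_max_right (n * r) (max τ 0)
    linarith
  · rintro ⟨x, t⟩ ⟨hx, ht⟩
    have h1 := cube_subset_closedBall n r hx
    rw [mem_closedBall_zero_iff] at h1
    have h2 := le_max_left (n * r) (max τ 0)
    have h3 := le_max_right (n * r) (max τ 0)
    have h4 := le_max_left τ 0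
    refine ⟨?_, ht.1, ?_⟩
    · simp only [ball0, mem_ball_zero_iff]; linarith
    · have := ht.2
      rw [rpow_one]; simp only at this ⊢; linarith

theorem box_subset_halfSp (n : ℕ) (r τ : ℝ) : box n r τ ⊆ halfSp n := fun _ hz => hz.2.1

/-- The space-time cutoff function built from one-dimensional plateaus. -/
def cutoff (n : ℕ) (r d τ δ : ℝ) (z : Spc n × ℝ) : ℝ :=
  (∏ i, plateau r d (z.1 i)) * plateau τ δ z.2

theorem contDiff_cutoff (n : ℕ) (r d τ δ : ℝ) : ContDiff ℝ (⊤ : ℕ∞) (cutoff n r d τ δ) := by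
  unfold cutoff
  refine ContDiff.mul (contDiff_prod fun i _ => ?_) ((contDiff_plateau τ δ le_rfl).comp contDiff_snd)
  exact (contDiff_plateau r d le_rfl).comp (by fun_prop)

theorem hasCompactSupport_cutoff (n : ℕ) {r d τ δ : ℝ} (hr : 0 < r) (hd : 0 < d) (hτ : 0 < τ)
    (hδ : 0 < δ) : HasCompactSupport (cutoff n r d τ δ) := by
  refine HasCompactSupport.of_support_subset_isCompact
    ((isCompact_closedBall (0 : Spc n) (n * (r + d))).prod (isCompact_Icc (a := -(τ + δ)) (b := τ + δ)))
    ?_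
  intro z hz
  have h1 : (∏ i, plateau r d (z.1 i)) ≠ 0 := left_ne_zero_of_mul hz
  have h2 : plateau τ δ z.2 ≠ 0 := right_ne_zero_of_mul hz
  refine ⟨cube_subset_closedBall n _ fun i => ?_, abs_le.1 ?_⟩
  · by_contra! h
    exact h1 (Finset.prod_eq_zero (Finset.mem_univ i) (plateau_eq_zero hr hd h.le))
  · by_contra! h
    exact h2 (plateau_eq_zero hτ hδ h.le)

theorem cutoff_nonneg (n : ℕ) {r d τ δ : ℝ} (hr : 0 < r) (hd : 0 < d) (hτ : 0 < τ)
    (hδ : 0 < δ) (z) : 0 ≤ cutoff n r d τ δ z :=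
  mul_nonneg (Finset.prod_nonneg fun _ _ => (plateau_mem_Icc hr hd _).1) (plateau_mem_Icc hτ hδ _).1

theorem prod_plateau_mem_Icc (n : ℕ) {r d : ℝ} (hr : 0 < r) (hd : 0 < d) (x : Spc n) :
    ∏ i, plateau r d (x i) ∈ Icc (0 : ℝ) 1 :=
  ⟨Finset.prod_nonneg fun _ _ => (plateau_mem_Icc hr hd _).1,
    Finset.prod_le_one (fun _ _ => (plateau_mem_Icc hr hd _).1) fun _ _ => (plateau_mem_Icc hr hd _).2⟩

theorem cutoff_le_one (n : ℕ) {r d τ δ : ℝ} (hr : 0 < r) (hd : 0 < d) (hτ : 0 < τ)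
    (hδ : 0 < δ) (z) : cutoff n r d τ δ z ≤ 1 :=
  mul_le_one₀ (prod_plateau_mem_Icc n hr hd _).2 (plateau_mem_Icc hτ hδ _).1
    (plateau_mem_Icc hτ hδ _).2

theorem cutoff_eq_one (n : ℕ) {r d τ δ : ℝ} (hd : 0 < d) (hδ : 0 < δ) {z} (hz : z ∈ box n r τ) :
    cutoff n r d τ δ z = 1 := by
  unfold cutoff
  rw [plateau_eq_one hδ (by rw [abs_of_pos hz.2.1]; exact hz.2.2), mul_one]
  exact Finset.prod_eq_one fun i _ => plateau_eq_one hd (hz.1 i)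

theorem iterate_tDeriv_mul (n : ℕ) (g : Spc n → ℝ) (h : ℝ → ℝ) (l : ℕ) :
    (tDeriv n)^[l] (fun z => g z.1 * h z.2) = fun z => g z.1 * (deriv^[l] h) z.2 := by
  induction l with
  | zero => rfl
  | succ l ih =>
    rw [Function.iterate_succ_apply', ih]
    funext z
    simp only [tDeriv, deriv_const_mul_field, Function.iterate_succ_apply']

theorem spDeriv_prod (n : ℕ) (i : Fin n) (H : Fin n → ℝ → ℝ) (h : ℝ → ℝ) :
    spDeriv n i (fun z => (∏ j, H j (z.1 j)) * h z.2)
      = fun z => (∏ j, Function.update H i (deriv (H i)) j (z.1 j)) * h z.2 := by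
  funext z
  have e : ∀ G : ℝ → ℝ, (∏ j, Function.update H i G j (z.1 j))
      = G (z.1 i) * ∏ j ∈ Finset.univ.erase i, H j (z.1 j) := by
    intro G
    rw [← Finset.mul_prod_erase _ _ (Finset.mem_univ i), Function.update_self]
    congr 1
    refine Finset.prod_congr rfl fun j hj => ?_
    rw [Function.update_of_ne (Finset.ne_of_mem_erase hj)]
  have e2 : ∀ s : ℝ, (∏ j, H j ((z.1 + s • EuclideanSpace.single i (1 : ℝ)) j))
      = (∏ j ∈ Finset.univ.erase i, H j (z.1 j)) * H i (z.1 i + s) := by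
    intro s
    rw [← Finset.mul_prod_erase _ _ (Finset.mem_univ i), mul_comm]
    congr 1
    · refine Finset.prod_congr rfl fun j hj => ?_
      simp [Finset.ne_of_mem_erase hj]
    · simp
  simp only [spDeriv, e2, e]
  rw [deriv_mul_const_field, deriv_const_mul_field, deriv_comp_const_add, add_zero, mul_comm (deriv _ _)]

theorem iterate_spDeriv_prod (n : ℕ) (i : Fin n) (l : ℕ) (H : Fin n → ℝ → ℝ) (h : ℝ → ℝ) :
    (spDeriv n i)^[l] (fun z => (∏ j, H j (z.1 j)) * h z.2)
      = fun z => (∏ j, Function.update H i (deriv^[l] (H i)) j (z.1 j)) * h z.2 := by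
  induction l with
  | zero => simp
  | succ l ih =>
    rw [Function.iterate_succ_apply', ih, spDeriv_prod]
    simp [Function.iterate_succ_apply']

theorem mDeriv_prod (n : ℕ) (α : Fin n → ℕ) (g h : ℝ → ℝ) :
    mDeriv n α (fun z => (∏ j, g (z.1 j)) * h z.2)
      = fun z => (∏ j, (deriv^[α j] g) (z.1 j)) * h z.2 := by
  have key : ∀ L : List (Fin n), L.Nodup →
      L.foldr (fun i ψ => (spDeriv n i)^[α i] ψ) (fun z => (∏ j, g (z.1 j)) * h z.2)
        = fun z => (∏ j, (if j ∈ L then deriv^[α j] g else g) (z.1 j)) * h z.2 := by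
    intro L hL
    induction L with
    | nil => simp
    | cons i L ih =>
      rw [List.nodup_cons] at hL
      rw [List.foldr_cons, ih hL.2,
        iterate_spDeriv_prod n i (α i) (fun j => if j ∈ L then deriv^[α j] g else g) h]
      funext z
      congr 1
      refine Finset.prod_congr rfl fun j _ => ?_
      by_cases hj : j = i
      · subst hj; simp [hL.1]
      · simp [hj]
  rw [mDeriv, key _ (List.nodup_finRange n)]
  simp

theorem abs_iterate_tDeriv_cutoff_le (n : ℕ) {r d τ δ K : ℝ} {l : ℕ} (hr : 0 < r) (hd : 0 < d)
    (hτ : 0 < τ) (hδ : 0 < δ) (hK : ∀ s, |(deriv^[l] (plateau τ δ)) s| ≤ K)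
    {z : Spc n × ℝ} (hz : z ∈ halfSp n) :
    |(tDeriv n)^[l] (cutoff n r d τ δ) z| ≤ (box n (r + d) (τ + δ)).indicator (fun _ => K) z := by
  have e : (tDeriv n)^[l] (cutoff n r d τ δ) z = _ :=
    congrFun (iterate_tDeriv_mul n (fun x => ∏ i, plateau r d (x i)) (plateau τ δ) l) z
  rw [e]
  by_cases hb : z ∈ box n (r + d) (τ + δ)
  · rw [indicator_of_mem hb, abs_mul, abs_of_nonneg (prod_plateau_mem_Icc n hr hd _).1]
    exact (mul_le_of_le_one_left (abs_nonneg _) (prod_plateau_mem_Icc n hr hd _).2).trans (hK _)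
  · rw [indicator_of_notMem hb, abs_nonpos_iff, mul_eq_zero]
    by_cases hx : z.1 ∈ cube n (r + d)
    · right
      refine iterate_deriv_plateau_of_lt_abs hτ hδ ?_ l
      rw [abs_of_pos hz]
      by_contra! h
      exact hb ⟨hx, hz, h⟩
    · left
      simp only [cube, mem_ofPred_eq, not_forall, not_le] at hx
      obtain ⟨i, hi⟩ := hx
      exact Finset.prod_eq_zero (Finset.mem_univ i) (plateau_eq_zero hr hd hi.le)

theorem abs_mDeriv_cutoff_le (n : ℕ) {r d τ δ : ℝ} {K : ℕ → ℝ} {α : Fin n → ℕ} (hr : 0 < r)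
    (hd : 0 < d) (hτ : 0 < τ) (hδ : 0 < δ)
    (hK : ∀ l s, |(deriv^[l] (plateau r d)) s| ≤ K l)
    {z : Spc n × ℝ} (hz : z ∈ halfSp n) :
    |mDeriv n α (cutoff n r d τ δ) z|
      ≤ (box n (r + d) (τ + δ)).indicator (fun _ => ∏ i, K (α i)) z := by
  have e : mDeriv n α (cutoff n r d τ δ) z = _ :=
    congrFun (mDeriv_prod n α (plateau r d) (plateau τ δ)) z
  rw [e]
  by_cases hb : z ∈ box n (r + d) (τ + δ)
  · rw [indicator_of_mem hb, abs_mul, abs_of_nonneg (plateau_mem_Icc hτ hδ _).1]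
    refine (mul_le_of_le_one_right (abs_nonneg _) (plateau_mem_Icc hτ hδ _).2).trans ?_
    rw [Finset.abs_prod]
    exact Finset.prod_le_prod (fun _ _ => abs_nonneg _) fun i _ => hK _ _
  · rw [indicator_of_notMem hb, abs_nonpos_iff, mul_eq_zero]
    by_cases hx : z.1 ∈ cube n (r + d)
    · right
      refine plateau_eq_zero hτ hδ ?_
      rw [abs_of_pos hz]
      by_contra! h
      exact hb ⟨hx, hz, h.le⟩
    · left
      simp only [cube, mem_ofPred_eq, not_forall, not_le] at hx
      obtain ⟨i, hi⟩ := hx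
      exact Finset.prod_eq_zero (Finset.mem_univ i) (iterate_deriv_plateau_of_lt_abs hr hd hi _)

theorem ConvexOn.continuousOn_Ici_of_monotoneOn {g : ℝ → ℝ} (hc : ConvexOn ℝ (Ici 0) g)
    (hm : MonotoneOn g (Ici 0)) : ContinuousOn g (Ici 0) := by
  intro x hx
  rcases (mem_Ici.1 hx).eq_or_lt with rfl | hx0
  · have hup : Tendsto (fun y : ℝ => (1 - y) * g 0 + y * g 1) (nhdsWithin 0 (Ici 0)) (nhds (g 0)) := by
      have : Continuous fun y : ℝ => (1 - y) * g 0 + y * g 1 := by fun_prop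
      simpa using (this.tendsto 0).mono_left nhdsWithin_le_nhds
    refine tendsto_of_tendsto_of_tendsto_of_le_of_le' tendsto_const_nhds hup ?_ ?_
    · filter_upwards [self_mem_nhdsWithin] with y hy using hm hx hy hy
    · have h1 : ∀ᶠ y in nhdsWithin (0 : ℝ) (Ici 0), y < 1 :=
        nhdsWithin_le_nhds (eventually_lt_nhds zero_lt_one)
      filter_upwards [self_mem_nhdsWithin, h1] with y hy hy1
      have := hc.2 hx (by simp : (1 : ℝ) ∈ Ici 0) (by linarith : 0 ≤ 1 - y) hy (by ring)
      simpa using this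
  · have hi : ContinuousOn g (Ioi 0) := by
      have := hc.continuousOn_interior
      rwa [interior_Ici] at this
    exact (hi.continuousAt (Ioi_mem_nhds hx0)).continuousWithinAt

/-- A mean-value consequence of Jensen's inequality. -/
theorem setIntegral_le_of_setIntegral_comp_lt {X : Type*} [MeasurableSpace X] {μ : Measure X}
    {S : Set X} (hS0 : μ S ≠ 0) (hS : μ S ≠ ⊤) {g : ℝ → ℝ} (hc : ConvexOn ℝ (Ici 0) g)
    (hm : MonotoneOn g (Ici 0)) {w : X → ℝ} (hw0 : ∀ x, 0 ≤ w x) (hw : IntegrableOn w S μ)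
    (hgw : IntegrableOn (fun x => g (w x)) S μ) {c : ℝ} (hc0 : 0 ≤ c)
    (h : ∫ x in S, g (w x) ∂μ < g c * μ.real S) : ∫ x in S, w x ∂μ ≤ c * μ.real S := by
  have hV : 0 < μ.real S := ENNReal.toReal_pos hS0 hS
  have hJ := hc.map_set_average_le (hc.continuousOn_Ici_of_monotoneOn hm) isClosed_Ici hS0 hS
    (Eventually.of_forall hw0) hw hgw
  rw [setAverage_eq, setAverage_eq, smul_eq_mul, smul_eq_mul] at hJ
  by_contra! hlt
  have h1 : c ≤ (μ.real S)⁻¹ * ∫ x in S, w x ∂μ := by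
    rw [inv_mul_eq_div, le_div_iff₀ hV]; exact hlt.le
  have h2 := (hm hc0 (hc0.trans h1 : _ ∈ Ici (0 : ℝ)) h1).trans hJ
  rw [inv_mul_eq_div, le_div_iff₀ hV] at h2
  linarith

theorem setIntegral_indicator_halfSp (n : ℕ) (r τ : ℝ) (w : Spc n × ℝ → ℝ) :
    ∫ z in halfSp n, (box n r τ).indicator w z = ∫ z in box n r τ, w z := by
  rw [setIntegral_indicator (measurableSet_box n r τ),
    inter_eq_self_of_subset_right (box_subset_halfSp n r τ)]

theorem measurableSet_halfSp (n : ℕ) : MeasurableSet (halfSp n) :=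
  measurableSet_lt measurable_const measurable_snd

/-- The local energy estimate obtained by testing the inequality with a cutoff. -/
theorem exists_energy_estimate {n k m : ℕ} {A p : ℝ} (hA : 0 < A)
    {a : (Fin n → ℕ) → Spc n × ℝ → ℝ → ℝ} (ha : GoodCoeffs n m A p a)
    {f : ℝ → ℝ} (hf : ∀ ζ, 0 ≤ ζ → 0 ≤ f ζ)
    {u0 : ℕ → Spc n → ℝ} (hu0nn : ∀ᵐ x ∂(volume : Measure (Spc n)), 0 ≤ u0 (k - 1) x)
    {u : Spc n × ℝ → ℝ} (hu : IsGlobalWeakSol n k m p a f u0 u) :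
    ∃ C : ℝ, 0 < C ∧ ∀ r d τ δ : ℝ, 0 < r → 0 < d → 0 < τ → 0 < δ →
      ∫ z in box n r τ, f |u z| ≤
        C * ((δ⁻¹) ^ k * (∫ z in box n (r + d) (τ + δ), |u z|)
          + (d⁻¹) ^ m * ∫ z in box n (r + d) (τ + δ), |u z| ^ p) := by
  choose K hK0 hK using exists_bound_iterate_deriv_plateau
  set Cα : ℝ := A * ∑ α ∈ mIdx n m, ∏ i, K (α i) with hCα
  have hCα0 : 0 ≤ Cα :=
    mul_nonneg hA.le (Finset.sum_nonneg fun α _ => Finset.prod_nonneg fun i _ => hK0 _)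
  refine ⟨K k + Cα + 1, by linarith [hK0 k], fun r d τ δ hr hd hτ hδ => ?_⟩
  obtain ⟨ρ, hρ, hsub⟩ := exists_box_subset_cyl n (r + d) (τ + δ)
  obtain ⟨hu1, hup, huf, hweak⟩ := hu
  set S := box n (r + d) (τ + δ) with hS
  have hSm : MeasurableSet S := measurableSet_box _ _ _
  have hSH : S ⊆ halfSp n := box_subset_halfSp _ _ _
  have hi1 : IntegrableOn (fun z => |u z|) S := ((hu1 ρ hρ).mono_set hsub).abs
  have hip : IntegrableOn (fun z => |u z| ^ p) S := (hup ρ hρ).mono_set hsub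
  have hif : IntegrableOn (fun z => f |u z|) S := (huf ρ hρ).mono_set hsub
  have hw := hweak (cutoff n r d τ δ) (contDiff_cutoff n r d τ δ)
    (hasCompactSupport_cutoff n hr hd hτ hδ) (cutoff_nonneg n hr hd hτ hδ)
  have hmem : ∀ᵐ z ∂(volume.restrict (halfSp n)), z ∈ halfSp n :=
    ae_restrict_mem (measurableSet_halfSp n)
  have hI : 0 ≤ ∫ x : Spc n, ∑ i ∈ Finset.range k,
      (-1 : ℝ) ^ i * u0 (k - 1 - i) x * (tDeriv n)^[i] (cutoff n r d τ δ) (x, 0) := by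
    refine integral_nonneg_of_ae ?_
    filter_upwards [hu0nn] with x hx
    have e : ∀ i, (tDeriv n)^[i] (cutoff n r d τ δ) (x, 0) = _ := fun i =>
      congrFun (iterate_tDeriv_mul n (fun x => ∏ i, plateau r d (x i)) (plateau τ δ) i) (x, 0)
    refine Finset.sum_nonneg fun i _ => ?_
    rw [e]
    rcases Nat.eq_zero_or_pos i with rfl | hi
    · simp only [pow_zero, one_mul, Nat.sub_zero, Function.iterate_zero, id]
      exact mul_nonneg hx (mul_nonneg (prod_plateau_mem_Icc n hr hd x).1 (plateau_mem_Icc hτ hδ 0).1)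
    · simp [iterate_deriv_plateau_zero hτ hδ hi]
  have hT : (∫ z in halfSp n, (-1 : ℝ) ^ k * u z * (tDeriv n)^[k] (cutoff n r d τ δ) z)
      ≤ K k * (δ⁻¹) ^ k * ∫ z in S, |u z| := by
    refine (le_abs_self _).trans ?_
    rw [← integral_const_mul, ← setIntegral_indicator_halfSp, ← Real.norm_eq_abs]
    refine norm_integral_le_of_norm_le
      ((integrable_indicator_iff hSm).2 (hi1.const_mul _)).integrableOn ?_
    filter_upwards [hmem] with z hz
    have h1 := abs_iterate_tDeriv_cutoff_le n hr hd hτ hδ (hK k τ δ hτ hδ) hz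
    rw [Real.norm_eq_abs, abs_mul, abs_mul, abs_pow, abs_neg, abs_one, one_pow, one_mul]
    refine (mul_le_mul_of_nonneg_left h1 (abs_nonneg _)).trans (le_of_eq ?_)
    by_cases hzS : z ∈ S
    · rw [indicator_of_mem hzS, indicator_of_mem hzS, mul_comm]
    · rw [indicator_of_notMem hzS, indicator_of_notMem hzS, mul_zero]
  have hX : -(∫ z in halfSp n, ∑ α ∈ mIdx n m,
      (-1 : ℝ) ^ m * a α z (u z) * mDeriv n α (cutoff n r d τ δ) z)
      ≤ Cα * (d⁻¹) ^ m * ∫ z in S, |u z| ^ p := by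
    refine (neg_le_abs _).trans ?_
    rw [← integral_const_mul, ← setIntegral_indicator_halfSp, ← Real.norm_eq_abs]
    refine norm_integral_le_of_norm_le
      ((integrable_indicator_iff hSm).2 (hip.const_mul _)).integrableOn ?_
    have hga : ∀ᵐ z ∂(volume.restrict (halfSp n)), ∀ α ∈ mIdx n m,
        ∀ ζ : ℝ, |a α z ζ| ≤ A * |ζ| ^ p :=
      (ae_ball_iff (mIdx n m).countable_toSet).2 fun α hα => (ha α hα).2.2
    filter_upwards [hmem, hga] with z hz hz2
    have hb : ∀ α ∈ mIdx n m,
        ‖(-1 : ℝ) ^ m * a α z (u z) * mDeriv n α (cutoff n r d τ δ) z‖ ≤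
        A * |u z| ^ p * S.indicator (fun _ => (∏ i, K (α i)) * (d⁻¹) ^ m) z := by
      intro α hα
      have h1 := abs_mDeriv_cutoff_le n (α := α) hr hd hτ hδ (fun l => hK l r d hr hd) hz
      have h2 : ∏ i, K (α i) * (d⁻¹) ^ (α i) = (∏ i, K (α i)) * (d⁻¹) ^ m := by
        rw [Finset.prod_mul_distrib, Finset.prod_pow_eq_pow_sum, (Finset.mem_filter.1 hα).2]
      rw [h2] at h1
      rw [Real.norm_eq_abs, abs_mul, abs_mul, abs_pow, abs_neg, abs_one, one_pow, one_mul]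
      exact mul_le_mul (hz2 α hα _) h1 (abs_nonneg _) (by positivity)
    refine (norm_sum_le_of_le _ hb).trans (le_of_eq ?_)
    rw [← hS]
    by_cases hzS : z ∈ S
    · simp only [indicator_of_mem hzS, hCα]
      rw [← Finset.mul_sum, ← Finset.sum_mul]
      ring
    · simp [indicator_of_notMem hzS]
  have hF : ∫ z in box n r τ, f |u z| ≤ ∫ z in halfSp n, f |u z| * cutoff n r d τ δ z := by
    have hsub2 : box n r τ ⊆ S := box_mono n (by linarith) (by linarith)
    have hgint : IntegrableOn (fun z => f |u z| * cutoff n r d τ δ z) S :=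
      hif.mul_bdd (c := 1) (contDiff_cutoff n r d τ δ).continuous.aestronglyMeasurable
        (Eventually.of_forall fun z => by
          rw [Real.norm_eq_abs, abs_of_nonneg (cutoff_nonneg n hr hd hτ hδ z)]
          exact cutoff_le_one n hr hd hτ hδ z)
    have e1 : ∫ z in box n r τ, f |u z| = ∫ z in box n r τ, f |u z| * cutoff n r d τ δ z := by
      refine setIntegral_congr_fun (measurableSet_box _ _ _) fun z hz => ?_
      simp only [cutoff_eq_one n hd hδ hz, mul_one]
    have e2 : ∫ z in S, f |u z| * cutoff n r d τ δ z
        = ∫ z in halfSp n, f |u z| * cutoff n r d τ δ z := by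
      symm
      refine setIntegral_eq_of_subset_of_forall_sdiff_eq_zero (measurableSet_halfSp n) hSH ?_
      intro z hz
      have h0 := abs_iterate_tDeriv_cutoff_le n (l := 0) (K := 1) hr hd hτ hδ (fun s => by
        have := plateau_mem_Icc hτ hδ s
        rw [Function.iterate_zero, id, abs_of_nonneg this.1]; exact this.2) hz.1
      rw [indicator_of_notMem hz.2, Function.iterate_zero, id, abs_nonpos_iff] at h0
      rw [h0, mul_zero]
    rw [e1, ← e2]
    exact setIntegral_mono_set hgint (Eventually.of_forall fun z =>
      mul_nonneg (hf _ (abs_nonneg _)) (cutoff_nonneg n hr hd hτ hδ z)) hsub2.eventuallyLE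
  have hU : 0 ≤ (δ⁻¹) ^ k * ∫ z in S, |u z| :=
    mul_nonneg (by positivity) (integral_nonneg fun z => abs_nonneg _)
  have hP : 0 ≤ (d⁻¹) ^ m * ∫ z in S, |u z| ^ p :=
    mul_nonneg (by positivity) (integral_nonneg fun z => by positivity)
  nlinarith [mul_nonneg hCα0 hU, mul_nonneg (hK0 k) hP]

/-- The geometric levels `0, 2, 4, 8, …`. -/
def level : ℕ → ℝ
  | 0 => 0
  | j + 1 => 2 ^ (j + 1)

theorem level_nonneg (j : ℕ) : 0 ≤ level j := by
  cases j <;> simp [level]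

theorem level_succ_pos (j : ℕ) : 0 < level (j + 1) := by simp [level]

theorem summable_dyadic {f : ℝ → ℝ} (hm : MonotoneOn f (Ici 0)) (hpos : ∀ ζ, 0 ≤ ζ → 0 < f ζ)
    {q s : ℝ} (hq : 0 ≤ q) (hs : 0 ≤ s)
    (hI : IntegrableOn (fun ζ : ℝ => ζ ^ (q - 1) / f ζ ^ s) (Ioi 1)) :
    Summable fun j : ℕ => ((2 : ℝ) ^ (j + 1)) ^ q / f (2 ^ (j + 1)) ^ s := by
  set g : ℝ → ℝ := fun ζ => ζ ^ (q - 1) / f ζ ^ s with hg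
  have hg0 : ∀ ζ, 0 < ζ → 0 ≤ g ζ := fun ζ hζ =>
    div_nonneg (rpow_nonneg hζ.le _) (rpow_nonneg (hpos ζ hζ.le).le _)
  have h1 : ∀ j : ℕ, (1 : ℝ) ≤ 2 ^ j := fun j => one_le_pow₀ (by norm_num)
  have hle : ∀ j : ℕ, (2 : ℝ) ^ j ≤ 2 ^ (j + 1) := fun j => by
    rw [pow_succ]; linarith [h1 j]
  have hii : ∀ i j : ℕ, i ≤ j → IntervalIntegrable g volume (2 ^ i) (2 ^ j) := fun i j hij => by
    rw [intervalIntegrable_iff_integrableOn_Ioc_of_le (pow_le_pow_right₀ (by norm_num) hij)]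
    exact hI.mono_set fun x hx => lt_of_le_of_lt (h1 i) hx.1
  have hlow : ∀ j : ℕ, ((2 : ℝ) ^ (j + 1)) ^ q / f (2 ^ (j + 1)) ^ s
      ≤ (2 * 2 ^ q) * ∫ x in ((2 : ℝ) ^ j)..(2 ^ (j + 1)), g x := by
    intro j
    have hj0 : (0 : ℝ) < 2 ^ j := by positivity
    have hfp := hpos (2 ^ (j + 1)) (by positivity)
    set c : ℝ := ((2 : ℝ) ^ j) ^ q / (2 ^ (j + 1)) / f (2 ^ (j + 1)) ^ s with hc
    have hcg : ∀ x ∈ Icc ((2 : ℝ) ^ j) (2 ^ (j + 1)), c ≤ g x := by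
      intro x hx
      have hx0 : 0 < x := hj0.trans_le hx.1
      have hfx := hpos x hx0.le
      have e : x ^ (q - 1) = x ^ q / x := by rw [rpow_sub_one hx0.ne']
      simp only [hc, hg, e]
      have hmono : f x ≤ f (2 ^ (j + 1)) := hm hx0.le (by simp) hx.2
      have n1 : ((2 : ℝ) ^ j) ^ q ≤ x ^ q := rpow_le_rpow hj0.le hx.1 hq
      have n2 : f x ^ s ≤ f (2 ^ (j + 1)) ^ s := rpow_le_rpow hfx.le hmono hs
      have n3 : 0 < f x ^ s := rpow_pos_of_pos hfx s
      exact div_le_div₀ (by positivity) (div_le_div₀ (by positivity) n1 hx0 hx.2) n3 n2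
    have hgint := intervalIntegral.integral_mono_on (hle j) (by simp) (hii j (j + 1) (by omega)) hcg
    rw [intervalIntegral.integral_const, smul_eq_mul] at hgint
    refine le_trans (le_of_eq ?_) (mul_le_mul_of_nonneg_left hgint (by positivity))
    rw [hc, pow_succ, mul_rpow hj0.le (by norm_num)]
    field_simp
    ring
  refine Summable.of_nonneg_of_le (fun j => div_nonneg (by positivity)
    (rpow_nonneg (hpos _ (by positivity)).le _)) hlow (Summable.mul_left _ ?_)
  refine summable_of_sum_range_le (c := ∫ x in Ioi 1, g x) (fun j => ?_) fun N => ?_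
  · exact intervalIntegral.integral_nonneg (hle j) fun x hx =>
      hg0 x (lt_of_lt_of_le (by positivity) hx.1)
  · rw [intervalIntegral.sum_integral_adjacent_intervals
      (a := fun j => (2 : ℝ) ^ j) fun j _ => hii j (j + 1) (by omega), pow_zero,
      intervalIntegral.integral_of_le (h1 N)]
    refine setIntegral_mono_set hI ?_ Ioc_subset_Ioi_self.eventuallyLE
    filter_upwards [ae_restrict_mem measurableSet_Ioi] with x hx
    exact hg0 x (zero_lt_one.trans hx)

theorem summable_step {f : ℝ → ℝ} (hm : MonotoneOn f (Ici 0)) (hpos : ∀ ζ, 0 ≤ ζ → 0 < f ζ)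
    {c e s : ℝ} (hc : 0 ≤ c) (he : 0 ≤ e) (hs : 0 ≤ s)
    (hI : IntegrableOn (fun ζ : ℝ => ζ ^ (e * s - 1) / f ζ ^ s) (Ioi 1)) :
    Summable fun j : ℕ => (c * level (j + 1) ^ e / f (level j)) ^ s := by
  rw [← summable_nat_add_iff 1]
  refine ((summable_dyadic hm hpos (mul_nonneg he hs) hs hI).mul_left ((c * 2 ^ e) ^ s)).congr ?_
  intro j
  have hfp := hpos (2 ^ (j + 1)) (by positivity)
  simp only [level]
  have h2 : (0 : ℝ) ≤ 2 ^ e := rpow_nonneg (by norm_num) e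
  have h3 : (0 : ℝ) ≤ (2 ^ (j + 1)) ^ e := rpow_nonneg (by positivity) e
  rw [pow_succ (2 : ℝ) (j + 1), mul_rpow (z := e) (by positivity) (by norm_num),
    rpow_mul (by positivity), mul_div_assoc', ← mul_rpow (mul_nonneg hc h2) h3,
    ← div_rpow (by positivity) hfp.le]
  ring_nf

/-- Under the dyadic summability condition `f` is unbounded along the levels. -/
theorem exists_lt_apply_level {f : ℝ → ℝ} (hpos : ∀ ζ, 0 ≤ ζ → 0 < f ζ) {s : ℝ} (hs : 0 < s)
    (hsum : Summable fun j : ℕ => (1 * level (j + 1) ^ (1 : ℝ) / f (level j)) ^ s) (B : ℝ) :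
    ∃ j, B < f (level j) := by
  by_contra! hB
  have hB0 : 0 < B := (hpos _ (level_nonneg 0)).trans_le (hB 0)
  have hlow : ∀ j, (B⁻¹) ^ s ≤ (1 * level (j + 1) ^ (1 : ℝ) / f (level j)) ^ s := by
    intro j
    refine rpow_le_rpow (by positivity) ?_ hs.le
    have h1 : (1 : ℝ) ≤ level (j + 1) := one_le_pow₀ (by norm_num)
    rw [one_mul, rpow_one, inv_eq_one_div]
    exact div_le_div₀ (by linarith) h1 (hpos _ (level_nonneg j)) (hB j)
  have := ge_of_tendsto' hsum.tendsto_atTop_zero hlow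
  exact absurd this (not_le.2 (rpow_pos_of_pos (inv_pos.2 hB0) s))

theorem tsum_add_sum_le_two_mul {d : ℕ → ℝ} (hd : ∀ j, 0 < d j) (hs : Summable d) (j : ℕ) :
    (∑' i, d i) + ∑ i ∈ Finset.range j, d i ≤ 2 * ∑' i, d i := by
  linarith [hs.sum_le_tsum (Finset.range j) fun i _ => (hd i).le]

/-- **Theorem 2.3.** If conditions (1.4), (1.5) hold and `f(0) > 0`, then problem
(1.1i), (1.1c) has no global weak solutions at all. -/
theorem no_global_weak_solution
    (n k m : ℕ) (hn : 1 ≤ n) (hk : 1 ≤ k) (hm : 1 ≤ m)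
    (A p : ℝ) (hA : 0 < A) (hp : 0 < p)
    (a : (Fin n → ℕ) → Spc n × ℝ → ℝ → ℝ) (ha : GoodCoeffs n m A p a)
    (f : ℝ → ℝ) (hf : GoodF p f)
    (u0 : ℕ → Spc n → ℝ) (hu0 : ∀ i < k, L1locInit n (u0 i))
    (hu0nn : ∀ᵐ x ∂(volume : Measure (Spc n)), 0 ≤ u0 (k - 1) x)
    (h14 : Cond14 k f) (h15 : Cond15 m p f)
    (hf0 : 0 < f 0) :
    ¬ ∃ u : Spc n × ℝ → ℝ, IsGlobalWeakSol n k m p a f u0 u := by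
  rintro ⟨u, hu⟩
  obtain ⟨hfm, hfc, hgm, hgc, hfpos⟩ := hf
  have hpos : ∀ ζ, 0 ≤ ζ → 0 < f ζ := fun ζ hζ => hf0.trans_le (hfm (by simp) hζ hζ)
  obtain ⟨C, hC, hE⟩ := exists_energy_estimate hA ha (fun ζ hζ => (hpos ζ hζ).le) hu0nn hu
  have hk0 : (0 : ℝ) < (k : ℝ)⁻¹ := inv_pos.2 (by exact_mod_cast hk)
  have hm0 : (0 : ℝ) < (m : ℝ)⁻¹ := inv_pos.2 (by exact_mod_cast hm)
  set c : ℝ := 4 * C * 2 ^ (n + 1) with hc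
  have hc0 : 0 < c := by positivity
  have h14' : IntegrableOn (fun ζ : ℝ => ζ ^ (1 * (k : ℝ)⁻¹ - 1) / f ζ ^ ((k : ℝ)⁻¹)) (Ioi 1) := by
    simpa only [one_mul, Cond14] using h14
  have h15' : IntegrableOn (fun ζ : ℝ => ζ ^ (p * (m : ℝ)⁻¹ - 1) / f ζ ^ ((m : ℝ)⁻¹)) (Ioi 1) := by
    simpa only [← div_eq_mul_inv, Cond15] using h15
  set δ : ℕ → ℝ := fun j => (c * level (j + 1) ^ (1 : ℝ) / f (level j)) ^ ((k : ℝ)⁻¹) with hδ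
  set d : ℕ → ℝ := fun j => (c * level (j + 1) ^ p / f (level j)) ^ ((m : ℝ)⁻¹) with hd
  have hδs : Summable δ := summable_step hfm hpos hc0.le zero_le_one hk0.le h14'
  have hds : Summable d := summable_step hfm hpos hc0.le hp.le hm0.le h15'
  have hbase : ∀ (e : ℝ) (j : ℕ), 0 < c * level (j + 1) ^ e / f (level j) := fun e j =>
    div_pos (mul_pos hc0 (rpow_pos_of_pos (level_succ_pos j) e)) (hpos _ (level_nonneg j))
  have hδ0 : ∀ j, 0 < δ j := fun j => rpow_pos_of_pos (hbase 1 j) _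
  have hd0 : ∀ j, 0 < d j := fun j => rpow_pos_of_pos (hbase p j) _
  have hδk : ∀ j, ((δ j)⁻¹) ^ k * level (j + 1) = f (level j) / c := by
    intro j
    have h1 := level_succ_pos j
    have h2 := hpos _ (level_nonneg j)
    rw [inv_pow, hδ, rpow_inv_natCast_pow (hbase 1 j).le (by omega), rpow_one]
    field_simp
  have hdm : ∀ j, ((d j)⁻¹) ^ m * level (j + 1) ^ p = f (level j) / c := by
    intro j
    have h1 := rpow_pos_of_pos (level_succ_pos j) p
    have h2 := hpos _ (level_nonneg j)
    rw [inv_pow, hd, rpow_inv_natCast_pow (hbase p j).le (by omega)]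
    field_simp
  set R : ℝ := ∑' i, d i with hR
  set T : ℝ := ∑' i, δ i with hT
  have hR0 : 0 < R := hds.tsum_pos (fun i => (hd0 i).le) 0 (hd0 0)
  have hT0 : 0 < T := hδs.tsum_pos (fun i => (hδ0 i).le) 0 (hδ0 0)
  set r : ℕ → ℝ := fun j => R + ∑ i ∈ Finset.range j, d i with hr
  set τ : ℕ → ℝ := fun j => T + ∑ i ∈ Finset.range j, δ i with hτ
  have hrR : ∀ j, R ≤ r j := fun j =>
    le_add_of_nonneg_right (Finset.sum_nonneg fun i _ => (hd0 i).le)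
  have hτT : ∀ j, T ≤ τ j := fun j =>
    le_add_of_nonneg_right (Finset.sum_nonneg fun i _ => (hδ0 i).le)
  have hr2 : ∀ j, r j ≤ 2 * R := tsum_add_sum_le_two_mul hd0 hds
  have hτ2 : ∀ j, τ j ≤ 2 * T := tsum_add_sum_le_two_mul hδ0 hδs
  have hrs : ∀ j, r (j + 1) = r j + d j := fun j => by
    simp only [hr, Finset.sum_range_succ, add_assoc]
  have hτs : ∀ j, τ (j + 1) = τ j + δ j := fun j => by
    simp only [hτ, Finset.sum_range_succ, add_assoc]
  obtain ⟨hu1, hup, huf, -⟩ := hu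
  obtain ⟨ρ, hρ, hsub⟩ := exists_box_subset_cyl n (2 * R) (2 * T)
  have hsubj : ∀ j, box n (r j) (τ j) ⊆ cyl n ρ 1 := fun j =>
    (box_mono n (hr2 j) (hτ2 j)).trans hsub
  set V : ℝ := (2 * R) ^ n * T with hV
  have hV0 : 0 < V := by positivity
  have hvol : ∀ j, volume.real (box n (r j) (τ j)) = (2 * r j) ^ n * τ j := fun j =>
    measureReal_box n (hR0.le.trans (hrR j)) (hT0.le.trans (hτT j))
  have hVle : ∀ j, V ≤ volume.real (box n (r j) (τ j)) := fun j => by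
    rw [hvol]
    have hrj := hR0.le.trans (hrR j)
    exact mul_le_mul (pow_le_pow_left₀ (by positivity) (by linarith [hrR j]) n) (hτT j)
      hT0.le (by positivity)
  have hleV : ∀ j, volume.real (box n (r j) (τ j)) ≤ 2 ^ (n + 1) * V := fun j => by
    have e : 2 ^ (n + 1) * V = (2 * (2 * R)) ^ n * (2 * T) := by
      rw [hV, mul_pow 2 (2 * R), pow_succ]; ring
    have hrj := hR0.le.trans (hrR j)
    rw [hvol, e]
    exact mul_le_mul (pow_le_pow_left₀ (by positivity) (by linarith [hr2 j]) n) (hτ2 j)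
      (hT0.le.trans (hτT j)) (by positivity)
  have hfin : ∀ j, volume (box n (r j) (τ j)) ≠ ⊤ := fun j => by
    rw [volume_box n (hR0.le.trans (hrR j))]; exact ENNReal.ofReal_ne_top
  have hne : ∀ j, volume (box n (r j) (τ j)) ≠ 0 := fun j h => by
    have := hV0.trans_le (hVle j)
    rw [measureReal_def, h] at this
    simp at this
  have hgrow : ∀ j, f (level j) * V ≤ ∫ z in box n (r j) (τ j), f |u z| := by
    intro j
    induction j with
    | zero =>
      have h1 : f 0 * volume.real (box n (r 0) (τ 0)) ≤ ∫ z in box n (r 0) (τ 0), f |u z| :=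
        setIntegral_ge_of_const_le_real (measurableSet_box _ _ _) (hfin 0)
          (fun z _ => hfm (by simp) (mem_Ici.2 (abs_nonneg _)) (abs_nonneg _)) ((huf ρ hρ).mono_set (hsubj 0))
      exact (mul_le_mul_of_nonneg_left (hVle 0) hf0.le).trans h1
    | succ j ih =>
      by_contra! hlt
      have hl0 := level_nonneg (j + 1)
      have hlt2 : ∫ z in box n (r (j + 1)) (τ (j + 1)), f |u z|
          < f (level (j + 1)) * volume.real (box n (r (j + 1)) (τ (j + 1))) :=
        hlt.trans_le (mul_le_mul_of_nonneg_left (hVle _) (hpos _ hl0).le)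
      have hU := setIntegral_le_of_setIntegral_comp_lt (hne (j + 1)) (hfin (j + 1)) hfc hfm
        (w := fun z => |u z|) (fun z => abs_nonneg _) ((hu1 ρ hρ).mono_set (hsubj _)).abs
        ((huf ρ hρ).mono_set (hsubj _)) hl0 hlt2
      have hroot : ∀ x : ℝ, 0 ≤ x → (x ^ p) ^ (1 / p) = x := fun x hx => by
        rw [one_div, rpow_rpow_inv hx hp.ne']
      have hW := setIntegral_le_of_setIntegral_comp_lt (hne (j + 1)) (hfin (j + 1)) hgc hgm
        (w := fun z => |u z| ^ p) (fun z => by positivity) ((hup ρ hρ).mono_set (hsubj _))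
        (by simpa only [hroot _ (abs_nonneg _)] using (huf ρ hρ).mono_set (hsubj _))
        (c := level (j + 1) ^ p) (rpow_nonneg hl0 p)
        (by simpa only [hroot _ (abs_nonneg _), hroot _ hl0] using hlt2)
      have hEj := hE (r j) (d j) (τ j) (δ j) (hR0.trans_le (hrR j)) (hd0 j) (hT0.trans_le (hτT j))
        (hδ0 j)
      rw [← hrs, ← hτs] at hEj
      have hδp : 0 ≤ ((δ j)⁻¹) ^ k := pow_nonneg (inv_nonneg.2 (hδ0 j).le) k
      have hdp : 0 ≤ ((d j)⁻¹) ^ m := pow_nonneg (inv_nonneg.2 (hd0 j).le) m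
      have h1 := mul_le_mul_of_nonneg_left hU hδp
      have h2 := mul_le_mul_of_nonneg_left hW hdp
      rw [← mul_assoc, hδk] at h1
      rw [← mul_assoc, hdm] at h2
      have hfj := hpos _ (level_nonneg j)
      have hfc0 : 0 ≤ f (level j) / c := by positivity
      have h3 := mul_le_mul_of_nonneg_left (hleV (j + 1)) hfc0
      have h4 := mul_le_mul_of_nonneg_left (add_le_add (h1.trans h3) (h2.trans h3)) hC.le
      have e : C * (f (level j) / c * (2 ^ (n + 1) * V) + f (level j) / c * (2 ^ (n + 1) * V))
          = f (level j) * V / 2 := by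
        rw [hc]; field_simp; ring
      rw [e] at h4
      have := mul_pos hfj hV0
      linarith [ih.trans (hEj.trans h4)]
  obtain ⟨j, hj⟩ := exists_lt_apply_level hpos hk0
    (summable_step hfm hpos zero_le_one zero_le_one hk0.le h14')
    ((∫ z in cyl n ρ 1, f |u z|) / V)
  rw [div_lt_iff₀ hV0] at hj
  refine absurd (hj.trans_le (hgrow j)) (not_lt.2 ?_)
  exact setIntegral_mono_set (huf ρ hρ)
    (Eventually.of_forall fun z => (hpos _ (abs_nonneg _)).le) (hsubj j).eventuallyLE
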